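/- (Mixed third derivative of the α-divergence on the diagonal) Let λ > 3 and α ∈ [−1,1]. The map (ã, b̃) ↦ D_α(φ̃^{-1}(ã) | φ̃^{-1}(b̃)) on L^λ(μ) × L^λ(μ) admits the mixed third partial Fréchet derivative D₁²D₂, and on the diagonal b̃ = ã it satisfies, for all ũ, ṽ, w̃ ∈ L^λ(μ), D₁²D₂D_α(φ̃^{-1}|φ̃^{-1})_{ã,ã}(ũ, ṽ; w̃) = −E_μ[(p/(1+p)²) Γ̃_α(ã,ũ,ṽ) w̃], where p = ψ(ã). -/

import Mathlib

open MeasureTheory Real Set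

section Holder

variable {X : Type*} [MeasurableSpace X] {μ : Measure X} [IsProbabilityMeasure μ] {lam : ℝ}

/-- Hölder's inequality for three functions and a fractional power of a fourth one. -/
lemma integrable_mul_rpow_and_integral_le {ε : ℝ} (hε : 0 ≤ ε) (hlam : 3 + ε ≤ lam)
    {f g k r : X → ℝ} (hf : MemLp f (ENNReal.ofReal lam) μ) (hg : MemLp g (ENNReal.ofReal lam) μ)
    (hk : MemLp k (ENNReal.ofReal lam) μ) (hr : MemLp r (ENNReal.ofReal lam) μ) :
    Integrable (fun x => |f x| * |g x| * |k x| * |r x| ^ ε) μ ∧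
      ∫ x, |f x| * |g x| * |k x| * |r x| ^ ε ∂μ ≤
        (eLpNorm f (ENNReal.ofReal lam) μ).toReal * (eLpNorm g (ENNReal.ofReal lam) μ).toReal *
        (eLpNorm k (ENNReal.ofReal lam) μ).toReal *
        (eLpNorm r (ENNReal.ofReal lam) μ).toReal ^ ε := by
  have hl : 0 < lam := by linarith
  have hl0 : ENNReal.ofReal lam ≠ 0 := by simpa using hl
  have key := ENNReal.lintegral_prod_norm_pow_le (μ := μ) (Finset.univ : Finset (Fin 5))
    (f := ![fun x => ‖f x‖ₑ ^ lam, fun x => ‖g x‖ₑ ^ lam, fun x => ‖k x‖ₑ ^ lam,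
      fun x => ‖r x‖ₑ ^ lam, fun _ => 1])
    (p := ![1 / lam, 1 / lam, 1 / lam, ε / lam, 1 - (3 + ε) / lam])
    (by
      have h1 := hf.1.enorm.pow_const lam
      have h2 := hg.1.enorm.pow_const lam
      have h3 := hk.1.enorm.pow_const lam
      have h4 := hr.1.enorm.pow_const lam
      intro i _
      fin_cases i
      exacts [h1, h2, h3, h4, aemeasurable_const])
    (by
      simp [Fin.sum_univ_five]
      field_simp
      ring)
    (by
      intro i _
      have : (3 + ε) / lam ≤ 1 := by rw [div_le_one hl]; exact hlam
      fin_cases i <;> simp <;> first | positivity | linarith)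
  have hN : ∀ h : X → ℝ, (∫⁻ x, ‖h x‖ₑ ^ lam ∂μ) ^ (1 / lam) =
      eLpNorm h (ENNReal.ofReal lam) μ := by
    intro h
    rw [eLpNorm_eq_lintegral_rpow_enorm_toReal hl0 ENNReal.ofReal_ne_top,
      ENNReal.toReal_ofReal hl.le]
  have hN' : (∫⁻ x, ‖r x‖ₑ ^ lam ∂μ) ^ (ε / lam) =
      eLpNorm r (ENNReal.ofReal lam) μ ^ ε := by
    rw [← hN, ← ENNReal.rpow_mul]
    congr 1
    ring
  have e1 : ∀ y : ℝ, (‖y‖ₑ ^ lam) ^ lam⁻¹ = ‖y‖ₑ := by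
    intro y
    rw [← ENNReal.rpow_mul, mul_inv_cancel₀ hl.ne', ENNReal.rpow_one]
  have e2 : ∀ y : ℝ, (‖y‖ₑ ^ lam) ^ (ε / lam) = ‖|y| ^ ε‖ₑ := by
    intro y
    rw [← ENNReal.rpow_mul, mul_div_cancel₀ _ hl.ne', Real.enorm_rpow_of_nonneg (abs_nonneg _) hε,
      enorm_abs]
  simp only [Fin.prod_univ_five] at key
  simp only [Matrix.cons_val] at key
  simp only [hN, hN'] at key
  simp only [one_div, e1, e2] at key
  simp only [lintegral_const, measure_univ, mul_one, ENNReal.one_rpow] at key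
  have hconv : ∫⁻ x, ‖|f x| * |g x| * |k x| * |r x| ^ ε‖ₑ ∂μ ≤
      eLpNorm f (ENNReal.ofReal lam) μ * eLpNorm g (ENNReal.ofReal lam) μ *
      eLpNorm k (ENNReal.ofReal lam) μ * eLpNorm r (ENNReal.ofReal lam) μ ^ ε := by
    simpa only [enorm_mul, enorm_abs] using key
  have hfin : eLpNorm f (ENNReal.ofReal lam) μ * eLpNorm g (ENNReal.ofReal lam) μ *
      eLpNorm k (ENNReal.ofReal lam) μ * eLpNorm r (ENNReal.ofReal lam) μ ^ ε < ⊤ := by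
    have := ENNReal.rpow_lt_top_of_nonneg hε hr.2.ne
    exact ENNReal.mul_lt_top (ENNReal.mul_lt_top (ENNReal.mul_lt_top hf.2 hg.2) hk.2) this
  have hint : Integrable (fun x => |f x| * |g x| * |k x| * |r x| ^ ε) μ := by
    refine ⟨?_, lt_of_le_of_lt hconv hfin⟩
    exact ((hf.1.norm.mul hg.1.norm).mul hk.1.norm).mul
      (hr.1.norm.aemeasurable.pow_const ε).aestronglyMeasurable
  refine ⟨hint, ?_⟩
  rw [integral_eq_lintegral_of_nonneg_ae (.of_forall fun x => by positivity) hint.1]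
  have := ENNReal.toReal_mono hfin.ne hconv
  rw [ENNReal.toReal_mul, ENNReal.toReal_mul, ENNReal.toReal_mul, ← ENNReal.toReal_rpow] at this
  refine le_trans (le_of_eq ?_) this
  congr 1
  refine lintegral_congr fun x => ?_
  rw [Real.enorm_of_nonneg (by positivity)]

end Holder

/-- Taylor remainder under a Hölder condition on the derivative. -/
lemma abs_sub_sub_le_of_holder {f f' : ℝ → ℝ} (hf : ∀ s, HasDerivAt f (f' s) s) {K ε : ℝ}
    (hε : 0 ≤ ε) (hK : 0 ≤ K) (h : ∀ s t, |f' s - f' t| ≤ K * |s - t| ^ ε) (s k : ℝ) :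
    |f (s + k) - f s - f' s * k| ≤ K * |k| * |k| ^ ε := by
  have := Convex.norm_image_sub_le_of_norm_hasDerivWithin_le
    (f := fun x => f x - f' s * x) (f' := fun x => f' x - f' s * 1) (s := uIcc s (s + k))
    (C := K * |k| ^ ε) (x := s) (y := s + k)
    (fun x _ => ((hf x).sub ((hasDerivAt_id x).const_mul (f' s))).hasDerivWithinAt)
    (fun x hx => by
      have h1 : |x - s| ≤ |k| := by
        simpa using abs_sub_left_of_mem_uIcc hx
      simp only [mul_one, Real.norm_eq_abs]
      exact (h x s).trans (by gcongr))
    (convex_uIcc _ _) left_mem_uIcc right_mem_uIcc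
  simp only [Real.norm_eq_abs] at this
  calc |f (s + k) - f s - f' s * k| = |f (s + k) - f' s * (s + k) - (f s - f' s * s)| := by
        congr 1; ring
    _ ≤ _ := this
    _ = _ := by rw [add_sub_cancel_left]; ring

lemma abs_sub_le_of_hasDerivAt_bound {f f' : ℝ → ℝ} (hf : ∀ s, HasDerivAt f (f' s) s) {K : ℝ}
    (h : ∀ s, |f' s| ≤ K) (s t : ℝ) : |f s - f t| ≤ K * |s - t| :=
  Convex.norm_image_sub_le_of_norm_hasDerivWithin_le (s := univ)
    (fun x _ => (hf x).hasDerivWithinAt) (fun x _ => h x) convex_univ (mem_univ _) (mem_univ _)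

/-- A bounded function with bounded derivative is Hölder of every exponent at most one. -/
lemma abs_sub_le_rpow_of_bounds {f f' : ℝ → ℝ} (hf : ∀ s, HasDerivAt f (f' s) s) {K ε : ℝ}
    (hε : 0 < ε) (hε1 : ε ≤ 1) (h0 : ∀ s, |f s| ≤ K) (h : ∀ s, |f' s| ≤ K) (s t : ℝ) :
    |f s - f t| ≤ 2 * K * |s - t| ^ ε := by
  have hK : 0 ≤ K := (abs_nonneg _).trans (h0 0)
  rcases le_total |s - t| 1 with h1 | h1
  · have h2 : |s - t| ≤ |s - t| ^ ε := by
      rcases (abs_nonneg (s - t)).eq_or_lt with h3 | h3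
      · rw [← h3, Real.zero_rpow hε.ne']
      · simpa using Real.rpow_le_rpow_of_exponent_ge h3 h1 hε1
    calc |f s - f t| ≤ K * |s - t| := abs_sub_le_of_hasDerivAt_bound hf h s t
      _ ≤ (2 * K) * |s - t| ^ ε := by gcongr; linarith
  · have h2 : 1 ≤ |s - t| ^ ε := Real.one_le_rpow h1 hε.le
    calc |f s - f t| ≤ |f s| + |f t| := abs_sub _ _
      _ ≤ 2 * K * 1 := by linarith [h0 s, h0 t]
      _ ≤ _ := by gcongr

lemma hasFDerivAt_of_norm_le_rpow {E F : Type*} [NormedAddCommGroup E] [NormedSpace ℝ E]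
    [NormedAddCommGroup F] [NormedSpace ℝ F] {f : E → F} {f' : E →L[ℝ] F} {a : E} {K ε : ℝ}
    (hε : 0 < ε) (h : ∀ k, ‖f (a + k) - f a - f' k‖ ≤ K * ‖k‖ * ‖k‖ ^ ε) :
    HasFDerivAt f f' a := by
  rw [hasFDerivAt_iff_isLittleO_nhds_zero]
  have h1 : (fun k : E => f (a + k) - f a - f' k) =O[nhds 0] fun k => ‖k‖ * ‖k‖ ^ ε :=
    Asymptotics.IsBigO.of_bound K (.of_forall fun k => by
      rw [Real.norm_of_nonneg (by positivity), ← mul_assoc]; exact h k)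
  have h2 : (fun k : E => ‖k‖ ^ ε) =o[nhds 0] fun _ => (1 : ℝ) := by
    rw [Asymptotics.isLittleO_one_iff]
    have : Continuous fun k : E => ‖k‖ ^ ε := continuous_norm.rpow_const fun _ => .inr hε.le
    simpa [Real.zero_rpow hε.ne'] using this.tendsto 0
  have h3 := (Asymptotics.isBigO_refl (fun k : E => ‖k‖) (nhds 0)).mul_isLittleO h2
  simp only [mul_one] at h3
  exact (h1.trans_isLittleO h3).of_norm_right

lemma continuous_of_norm_sub_le_rpow {E : Type*} [NormedAddCommGroup E] {F : Type*}
    [NormedAddCommGroup F] {f : E → F} {K ε : ℝ} (hε : 0 < ε)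
    (h : ∀ a b, ‖f a - f b‖ ≤ K * ‖a - b‖ ^ ε) : Continuous f := by
  rw [continuous_iff_continuousAt]
  intro b
  rw [ContinuousAt, tendsto_iff_norm_sub_tendsto_zero]
  have : Continuous fun a : E => K * ‖a - b‖ ^ ε := by
    refine continuous_const.mul ((continuous_id.sub continuous_const).norm.rpow_const
      fun _ => .inr hε.le)
  have h2 := this.tendsto b
  simp only [sub_self, norm_zero, Real.zero_rpow hε.ne', mul_zero] at h2
  exact squeeze_zero (fun _ => norm_nonneg _) (fun a => h a b) h2

/-- The mixed derivative `D₁²D₂` of a function of two variables in terms of curried partial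
derivatives. -/
lemma contDiff_two_and_hasFDerivAt_iteratedFDeriv {E : Type*} [NormedAddCommGroup E]
    [NormedSpace ℝ E] {D : E → E → ℝ} {A₁ : E → E → E →L[ℝ] ℝ} {A₂ : E → E → E →L[ℝ] E →L[ℝ] ℝ}
    {A₃ : E → E → E →L[ℝ] E →L[ℝ] E →L[ℝ] ℝ}
    (d1 : ∀ a b, HasFDerivAt (fun a' => D a' b) (A₁ a b) a)
    (d2 : ∀ a b, HasFDerivAt (fun a' => A₁ a' b) (A₂ a b) a)
    (c2 : ∀ b, Continuous fun a => A₂ a b)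
    (d3 : ∀ a b, HasFDerivAt (fun b' => A₂ a b') (A₃ a b) b) :
    (∀ b, ContDiff ℝ 2 (fun a => D a b)) ∧
    ∀ a b, DifferentiableAt ℝ (fun b' => iteratedFDeriv ℝ 2 (fun a' => D a' b') a) b ∧
      ∀ u v w, fderiv ℝ (fun b' => iteratedFDeriv ℝ 2 (fun a' => D a' b') a) b w ![u, v] =
        A₃ a b w u v := by
  let J : (E →L[ℝ] E →L[ℝ] ℝ) →L[ℝ] ContinuousMultilinearMap ℝ (fun _ : Fin 2 => E) ℝ :=
    ((continuousMultilinearCurryLeftEquiv ℝ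
      (fun _ : Fin 2 => E) ℝ).symm.toContinuousLinearEquiv.toContinuousLinearMap) ∘L
    (ContinuousLinearMap.compL ℝ E _ _
      ((continuousMultilinearCurryFin1 ℝ E ℝ).symm.toContinuousLinearEquiv.toContinuousLinearMap))
  have hJ : ∀ B m, J B m = B (m 0) (m 1) := fun B m => rfl
  have hit : ∀ a, (fun b' => iteratedFDeriv ℝ 2 (fun a' => D a' b') a) =
      fun b' => J (A₂ a b') := by
    intro a
    ext b' m
    rw [hJ, iteratedFDeriv_two_apply]
    have : fderiv ℝ (fun a' => D a' b') = fun a' => A₁ a' b' := funext fun a' => (d1 a' b').fderiv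
    rw [this, (d2 a b').fderiv]
  have d4 : ∀ a b, HasFDerivAt (fun b' => iteratedFDeriv ℝ 2 (fun a' => D a' b') a)
      (J ∘L A₃ a b) b := by
    intro a b
    rw [hit]
    have hJ' := J.hasFDerivAt (x := A₂ a b)
    exact (HasFDerivAt.comp (𝕜 := ℝ) (g := J) (f := A₂ a) b hJ' (d3 a b) :)
  refine ⟨fun b => ?_, fun a b => ⟨(d4 a b).differentiableAt, fun u v w => ?_⟩⟩
  · refine (contDiff_succ_iff_hasFDerivAt (n := 1)).2 ⟨fun a => A₁ a b, ?_, fun a => d1 a b⟩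
    exact contDiff_one_iff_hasFDerivAt.2 ⟨fun a => A₂ a b, c2 b, fun a => d2 a b⟩
  · rw [(d4 a b).fderiv]
    rfl

lemma integral_sub_sub {X : Type*} [MeasurableSpace X] {μ : Measure X} {f g k : X → ℝ}
    (hf : Integrable f μ) (hg : Integrable g μ) (hk : Integrable k μ) :
    ∫ x, f x ∂μ - ∫ x, g x ∂μ - ∫ x, k x ∂μ = ∫ x, (f x - g x - k x) ∂μ := by
  rw [← integral_sub hf hg]
  exact (integral_sub (hf.sub hg) hk).symm

section Nemytskii

variable {X : Type*} [MeasurableSpace X] {μ : Measure X} [IsProbabilityMeasure μ] {lam : ℝ}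

lemma integrable_and_abs_integral_le {ε : ℝ} (hε : 0 ≤ ε) (hlam : 3 + ε ≤ lam)
    {f g k r F : X → ℝ} (hf : MemLp f (ENNReal.ofReal lam) μ)
    (hg : MemLp g (ENNReal.ofReal lam) μ) (hk : MemLp k (ENNReal.ofReal lam) μ)
    (hr : MemLp r (ENNReal.ofReal lam) μ) (hF : AEStronglyMeasurable F μ) {C : ℝ} (hC : 0 ≤ C)
    (h : ∀ᵐ x ∂μ, |F x| ≤ C * (|f x| * |g x| * |k x| * |r x| ^ ε)) :
    Integrable F μ ∧ |∫ x, F x ∂μ| ≤ C * ((eLpNorm f (ENNReal.ofReal lam) μ).toReal *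
      (eLpNorm g (ENNReal.ofReal lam) μ).toReal * (eLpNorm k (ENNReal.ofReal lam) μ).toReal *
        (eLpNorm r (ENNReal.ofReal lam) μ).toReal ^ ε) := by
  obtain ⟨h1, h2⟩ := integrable_mul_rpow_and_integral_le hε hlam hf hg hk hr
  have h3 := h1.const_mul C
  refine ⟨h3.mono' hF h, ?_⟩
  calc |∫ x, F x ∂μ| ≤ ∫ x, C * (|f x| * |g x| * |k x| * |r x| ^ ε) ∂μ :=
        norm_integral_le_of_norm_le (f := F) h3 h
    _ = C * ∫ x, |f x| * |g x| * |k x| * |r x| ^ ε ∂μ := integral_const_mul _ _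
    _ ≤ _ := by gcongr

variable [Fact (1 ≤ ENNReal.ofReal lam)]

lemma exists_trilinear_integral (hlam : 3 ≤ lam) {g : X → ℝ} (hg : AEStronglyMeasurable g μ)
    {C : ℝ} (hC : ∀ x, |g x| ≤ C) :
    ∃ T : Lp ℝ (ENNReal.ofReal lam) μ →L[ℝ] Lp ℝ (ENNReal.ofReal lam) μ →L[ℝ]
      Lp ℝ (ENNReal.ofReal lam) μ →L[ℝ] ℝ,
      ∀ k h u, T k h u = ∫ x, g x * k x * h x * u x ∂μ := by
  have hC0 : 0 ≤ C := by
    obtain ⟨x⟩ := nonempty_of_isProbabilityMeasure μ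
    exact (abs_nonneg _).trans (hC x)
  have key : ∀ k h u : Lp ℝ (ENNReal.ofReal lam) μ,
      Integrable (fun x => g x * k x * h x * u x) μ ∧
        |∫ x, g x * k x * h x * u x ∂μ| ≤ C * (‖k‖ * ‖h‖ * ‖u‖) := by
    intro k h u
    have := integrable_and_abs_integral_le (ε := 0) (C := C) le_rfl (by linarith) (Lp.memLp k)
      (Lp.memLp h) (Lp.memLp u) (Lp.memLp u) (F := fun x => g x * k x * h x * u x)
      (((hg.mul (Lp.memLp k).1).mul (Lp.memLp h).1).mul (Lp.memLp u).1) hC0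
      (.of_forall fun x => by
        simp only [abs_mul, Real.rpow_zero, mul_one, mul_assoc]
        gcongr
        exact hC x)
    simpa [Lp.norm_def] using this
  have hB : ∀ k : Lp ℝ (ENNReal.ofReal lam) μ, ∃ B : Lp ℝ (ENNReal.ofReal lam) μ →L[ℝ]
      Lp ℝ (ENNReal.ofReal lam) μ →L[ℝ] ℝ, ∀ h u, B h u = ∫ x, g x * k x * h x * u x ∂μ := by
    intro k
    refine ⟨(LinearMap.mk₂ ℝ (fun h u => ∫ x, g x * k x * h x * u x ∂μ) ?_ ?_ ?_ ?_).mkContinuous₂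
      (C * ‖k‖) ?_, ?_⟩
    · intro h h' u
      rw [← integral_add (key k h u).1 (key k h' u).1]
      refine integral_congr_ae ?_
      filter_upwards [Lp.coeFn_add h h'] with x hx
      rw [hx, Pi.add_apply]; ring
    · intro c h u
      rw [smul_eq_mul, ← integral_const_mul]
      refine integral_congr_ae ?_
      filter_upwards [Lp.coeFn_smul c h] with x hx
      rw [hx, Pi.smul_apply, smul_eq_mul]; ring
    · intro h u u'
      rw [← integral_add (key k h u).1 (key k h u').1]
      refine integral_congr_ae ?_
      filter_upwards [Lp.coeFn_add u u'] with x hx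
      rw [hx, Pi.add_apply]; ring
    · intro c h u
      rw [smul_eq_mul, ← integral_const_mul]
      refine integral_congr_ae ?_
      filter_upwards [Lp.coeFn_smul c u] with x hx
      rw [hx, Pi.smul_apply, smul_eq_mul]; ring
    · intro h u
      exact ((key k h u).2).trans (le_of_eq (by ring))
    · intro h u
      rfl
  choose B hB using hB
  refine ⟨LinearMap.mkContinuous { toFun := B, map_add' := ?_, map_smul' := ?_ } C ?_, ?_⟩
  · intro k k'
    ext h u
    simp only [add_apply, hB]
    rw [← integral_add (key k h u).1 (key k' h u).1]
    refine integral_congr_ae ?_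
    filter_upwards [Lp.coeFn_add k k'] with x hx
    rw [hx, Pi.add_apply]; ring
  · intro c k
    ext h u
    simp only [smul_apply, hB, RingHom.id_apply]
    rw [smul_eq_mul, ← integral_const_mul]
    refine integral_congr_ae ?_
    filter_upwards [Lp.coeFn_smul c k] with x hx
    rw [hx, Pi.smul_apply, smul_eq_mul]; ring
  · intro k
    refine ContinuousLinearMap.opNorm_le_bound₂ _ (by positivity) fun h u => ?_
    simp only [LinearMap.coe_mk, AddHom.coe_mk, hB]
    exact ((key k h u).2).trans (le_of_eq (by ring))
  · intro k h u
    exact hB k h u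

lemma exists_bilinear_integral (hlam : 3 ≤ lam) {g : X → ℝ}
    (hg : MemLp g (ENNReal.ofReal lam) μ) :
    ∃ B : Lp ℝ (ENNReal.ofReal lam) μ →L[ℝ] Lp ℝ (ENNReal.ofReal lam) μ →L[ℝ] ℝ,
      ∀ h u, B h u = ∫ x, g x * h x * u x ∂μ := by
  obtain ⟨T, hT⟩ := exists_trilinear_integral (μ := μ) (lam := lam) hlam (g := fun _ => 1)
    aestronglyMeasurable_const (C := 1) (by simp)
  refine ⟨T hg.toLp, fun h u => ?_⟩
  rw [hT]
  refine integral_congr_ae ?_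
  filter_upwards [hg.coeFn_toLp] with x hx
  rw [hx, one_mul]

lemma exists_linear_integral (hlam : 3 ≤ lam) {g : X → ℝ}
    (hg : MemLp g (ENNReal.ofReal lam) μ) :
    ∃ A : Lp ℝ (ENNReal.ofReal lam) μ →L[ℝ] ℝ, ∀ u, A u = ∫ x, g x * u x ∂μ := by
  obtain ⟨B, hB⟩ := exists_bilinear_integral (μ := μ) hlam (memLp_const (1 : ℝ))
  refine ⟨B hg.toLp, fun u => ?_⟩
  rw [hB]
  refine integral_congr_ae ?_
  filter_upwards [hg.coeFn_toLp] with x hx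
  rw [hx, one_mul]

lemma memLp_comp_of_abs_le {f : ℝ → ℝ} (hf : Continuous f) {C : ℝ}
    (hC : ∀ s, |f s| ≤ C * (1 + |s|)) {a : X → ℝ} {p : ENNReal} (ha : MemLp a p μ) :
    MemLp (fun x => f (a x)) p μ := by
  have h1 : MemLp (fun x => 1 + ‖a x‖) p μ := (memLp_const (1 : ℝ)).add ha.norm
  refine MemLp.of_le_mul (c := C) h1 (hf.comp_aestronglyMeasurable ha.1) (.of_forall fun x => ?_)
  rw [Real.norm_of_nonneg (show (0 : ℝ) ≤ 1 + ‖a x‖ by positivity)]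
  exact hC _

lemma abs_le_of_hasDerivAt_bound {f f' : ℝ → ℝ} (hf : ∀ s, HasDerivAt f (f' s) s) {K : ℝ}
    (h : ∀ s, |f' s| ≤ K) (s : ℝ) : |f s| ≤ (|f 0| + K) * (1 + |s|) := by
  have h1 := abs_sub_le_of_hasDerivAt_bound hf h s 0
  have h2 : |f s| ≤ |f s - f 0| + |f 0| := by simpa using abs_add_le (f s - f 0) (f 0)
  have hK : 0 ≤ K := (abs_nonneg _).trans (h 0)
  rw [sub_zero] at h1
  nlinarith [abs_nonneg s, abs_nonneg (f 0), mul_nonneg (abs_nonneg s) (abs_nonneg (f 0))]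

lemma integrable_comp_of_abs_deriv_le {f f' : ℝ → ℝ} (hf : ∀ s, HasDerivAt f (f' s) s) {K : ℝ}
    (h : ∀ s, |f' s| ≤ K * (1 + |s|)) {a : X → ℝ} (ha : MemLp a 2 μ) :
    Integrable (fun x => f (a x)) μ := by
  have h1 : MemLp (fun x => 1 + ‖a x‖) 2 μ := (memLp_const (1 : ℝ)).add ha.norm
  have h2 : Integrable (fun x => (|f 0| + K) * (1 + ‖a x‖) ^ 2) μ := h1.integrable_sq.const_mul _
  have hcont : Continuous f := continuous_iff_continuousAt.2 fun s => (hf s).continuousAt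
  refine h2.mono' (hcont.comp_aestronglyMeasurable ha.1) (.of_forall fun x => ?_)
  have hK : 0 ≤ K := by simpa using (abs_nonneg _).trans (h 0)
  generalize a x = s
  have h3 := Convex.norm_image_sub_le_of_norm_hasDerivWithin_le
    (f := f) (f' := f') (s := uIcc 0 s) (C := K * (1 + |s|)) (x := 0) (y := s)
    (fun x _ => (hf x).hasDerivWithinAt)
    (fun x hx => by
      have h1 : |x| ≤ |s| := by
        simpa using abs_sub_left_of_mem_uIcc hx
      exact (h x).trans (by gcongr))
    (convex_uIcc _ _) left_mem_uIcc right_mem_uIcc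
  simp only [Real.norm_eq_abs, sub_zero] at h3 ⊢
  have h2 : |f s| ≤ |f s - f 0| + |f 0| := by simpa using abs_add_le (f s - f 0) (f 0)
  nlinarith [abs_nonneg s, abs_nonneg (f 0), mul_nonneg (abs_nonneg s) (abs_nonneg (f 0)),
    mul_nonneg (sq_nonneg s) (abs_nonneg (f 0)), mul_nonneg (abs_nonneg s) hK, sq_abs s]

lemma abs_add_mul_le {x y z C : ℝ} (hx : |x| ≤ C) (hy : |y| ≤ C) :
    |x + y * z| ≤ C * (1 + |z|) := by
  calc |x + y * z| ≤ |x| + |y| * |z| := by rw [← abs_mul]; exact abs_add_le _ _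
    _ ≤ C + C * |z| := by gcongr
    _ = _ := by ring

/-- The derivatives of the functional `(a, b) ↦ ∫ P(a) + Q(a) G(b) + R(b)` on `L^λ`, `λ > 3`. -/
theorem mixed_third_deriv_integral (hlam : 3 < lam)
    {P P₁ P₂ P₃ Q Q₁ Q₂ Q₃ G G₁ G₂ R R₁ : ℝ → ℝ} {C : ℝ}
    (hP : ∀ s, HasDerivAt P (P₁ s) s) (hP₁ : ∀ s, HasDerivAt P₁ (P₂ s) s)
    (hP₂ : ∀ s, HasDerivAt P₂ (P₃ s) s) (bP₂ : ∀ s, |P₂ s| ≤ C) (bP₃ : ∀ s, |P₃ s| ≤ C)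
    (hQ : ∀ s, HasDerivAt Q (Q₁ s) s) (hQ₁ : ∀ s, HasDerivAt Q₁ (Q₂ s) s)
    (hQ₂ : ∀ s, HasDerivAt Q₂ (Q₃ s) s) (bQ₁ : ∀ s, |Q₁ s| ≤ C) (bQ₂ : ∀ s, |Q₂ s| ≤ C)
    (bQ₃ : ∀ s, |Q₃ s| ≤ C)
    (hG : ∀ s, HasDerivAt G (G₁ s) s) (hG₁ : ∀ s, HasDerivAt G₁ (G₂ s) s)
    (bG₁ : ∀ s, |G₁ s| ≤ C) (bG₂ : ∀ s, |G₂ s| ≤ C)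
    (hR : ∀ s, HasDerivAt R (R₁ s) s) (bR₁ : ∀ s, |R₁ s| ≤ C * (1 + |s|))
    {Dv : Lp ℝ (ENNReal.ofReal lam) μ → Lp ℝ (ENNReal.ofReal lam) μ → ℝ}
    (hDv : ∀ a b, Dv a b = ∫ x, (P (a x) + Q (a x) * G (b x) + R (b x)) ∂μ) :
    (∀ b, ContDiff ℝ 2 (fun a => Dv a b)) ∧
    (∀ a b, DifferentiableAt ℝ (fun b' => iteratedFDeriv ℝ 2 (fun a' => Dv a' b') a) b) ∧
    (∀ a b u v w,
      fderiv ℝ (fun b' => iteratedFDeriv ℝ 2 (fun a' => Dv a' b') a) b w ![u, v] =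
        ∫ x, Q₂ (a x) * G₁ (b x) * w x * u x * v x ∂μ) := by
  have hC : 0 ≤ C := (abs_nonneg _).trans (bP₂ 0)
  have h3 : (3 : ℝ) ≤ lam := hlam.le
  obtain ⟨ε, hε, hε1, hεl⟩ : ∃ ε : ℝ, 0 < ε ∧ ε ≤ 1 ∧ 3 + ε ≤ lam :=
    ⟨min 1 (lam - 3), lt_min one_pos (by linarith), min_le_left _ _, by
      linarith [min_le_right 1 (lam - 3)]⟩
  have cont : ∀ {f f' : ℝ → ℝ}, (∀ s, HasDerivAt f (f' s) s) → Continuous f :=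
    fun hf => continuous_iff_continuousAt.2 fun s => (hf s).continuousAt
  have cP := cont hP; have cP₁ := cont hP₁; have cP₂ := cont hP₂
  have cQ := cont hQ; have cQ₁ := cont hQ₁; have cQ₂ := cont hQ₂
  have cG := cont hG; have cG₁ := cont hG₁
  have h2l : (2 : ENNReal) ≤ ENNReal.ofReal lam := by
    rw [← ENNReal.ofReal_ofNat]; exact ENNReal.ofReal_le_ofReal (by linarith)
  have mL2 : ∀ a : Lp ℝ (ENNReal.ofReal lam) μ, MemLp a 2 μ :=
    fun a => (Lp.memLp a).mono_exponent h2l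
  have mG : ∀ b : Lp ℝ (ENNReal.ofReal lam) μ, MemLp (fun x => G (b x)) (ENNReal.ofReal lam) μ :=
    fun b => memLp_comp_of_abs_le cG (abs_le_of_hasDerivAt_bound hG bG₁) (Lp.memLp b)
  have mW : ∀ b : Lp ℝ (ENNReal.ofReal lam) μ,
      MemLp (fun x => 1 + |G (b x)|) (ENNReal.ofReal lam) μ :=
    fun b => (memLp_const (1 : ℝ)).add (mG b).abs
  have m1 : MemLp (fun _ : X => (1 : ℝ)) (ENNReal.ofReal lam) μ := memLp_const 1
  -- integrability of the integrands
  have i0 : ∀ a b : Lp ℝ (ENNReal.ofReal lam) μ,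
      Integrable (fun x => P (a x) + Q (a x) * G (b x) + R (b x)) μ := by
    intro a b
    have mQ : MemLp (fun x => Q (a x)) 2 μ :=
      memLp_comp_of_abs_le cQ (abs_le_of_hasDerivAt_bound hQ bQ₁) (mL2 a)
    have mG2 : MemLp (fun x => G (b x)) 2 μ := (mG b).mono_exponent h2l
    refine ((integrable_comp_of_abs_deriv_le hP (K := |P₁ 0| + C) ?_ (mL2 a)).add
      (mQ.integrable_mul mG2)).add (integrable_comp_of_abs_deriv_le hR bR₁ (mL2 b))
    exact abs_le_of_hasDerivAt_bound hP₁ bP₂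
  have mF₁ : ∀ a b : Lp ℝ (ENNReal.ofReal lam) μ,
      MemLp (fun x => P₁ (a x) + Q₁ (a x) * G (b x)) (ENNReal.ofReal lam) μ := by
    intro a b
    have e1 := memLp_comp_of_abs_le cP₁ (abs_le_of_hasDerivAt_bound hP₁ bP₂) (Lp.memLp a)
    refine e1.add ?_
    refine MemLp.of_le_mul (c := C) (mG b)
      ((cQ₁.comp_aestronglyMeasurable (Lp.memLp a).1).mul (mG b).1) (.of_forall fun x => ?_)
    rw [norm_mul]
    gcongr
    exact bQ₁ _
  have mF₂ : ∀ a b : Lp ℝ (ENNReal.ofReal lam) μ,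
      MemLp (fun x => P₂ (a x) + Q₂ (a x) * G (b x)) (ENNReal.ofReal lam) μ := by
    intro a b
    refine MemLp.of_le_mul (c := C) (mW b)
      ((cP₂.comp_aestronglyMeasurable (Lp.memLp a).1).add
        ((cQ₂.comp_aestronglyMeasurable (Lp.memLp a).1).mul (mG b).1)) (.of_forall fun x => ?_)
    rw [Real.norm_of_nonneg (show 0 ≤ 1 + |G (b x)| by positivity)]
    exact abs_add_mul_le (bP₂ _) (bQ₂ _)
  choose A₁ hA₁ using fun a b => exists_linear_integral h3 (mF₁ a b)
  choose A₂ hA₂ using fun a b => exists_bilinear_integral h3 (mF₂ a b)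
  choose A₃ hA₃ using fun a b : Lp ℝ (ENNReal.ofReal lam) μ =>
    exists_trilinear_integral (μ := μ) h3 (g := fun x => Q₂ (a x) * G₁ (b x)) (C := C * C)
    ((cQ₂.comp_aestronglyMeasurable (Lp.memLp a).1).mul
      (cG₁.comp_aestronglyMeasurable (Lp.memLp b).1))
    (fun x => by rw [abs_mul]; gcongr; exacts [bQ₂ _, bG₁ _])
  have ilin : ∀ {g : X → ℝ}, MemLp g (ENNReal.ofReal lam) μ →
      ∀ u : Lp ℝ (ENNReal.ofReal lam) μ, Integrable (fun x => g x * u x) μ := fun hg u =>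
    (hg.mono_exponent h2l).integrable_mul (mL2 u)
  have ibil : ∀ {g : X → ℝ}, MemLp g (ENNReal.ofReal lam) μ →
      ∀ u v : Lp ℝ (ENNReal.ofReal lam) μ, Integrable (fun x => g x * u x * v x) μ :=
    fun hg u v => (integrable_and_abs_integral_le (ε := 0) le_rfl (by linarith) hg
      (Lp.memLp u) (Lp.memLp v) m1 ((hg.1.mul (Lp.memLp u).1).mul (Lp.memLp v).1) zero_le_one
      (.of_forall fun x => by simp [abs_mul])).1
  have itri : ∀ a b k u v : Lp ℝ (ENNReal.ofReal lam) μ,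
      Integrable (fun x => Q₂ (a x) * G₁ (b x) * k x * u x * v x) μ :=
    fun a b k u v => (integrable_and_abs_integral_le (ε := 0) (C := C * C) le_rfl (by linarith)
      (Lp.memLp k) (Lp.memLp u) (Lp.memLp v) m1
      (F := fun x => Q₂ (a x) * G₁ (b x) * k x * u x * v x)
      (((((cQ₂.comp_aestronglyMeasurable (Lp.memLp a).1).mul
      (cG₁.comp_aestronglyMeasurable (Lp.memLp b).1)).mul (Lp.memLp k).1).mul
      (Lp.memLp u).1).mul (Lp.memLp v).1) (by positivity)
      (.of_forall fun x => by
        simp only [abs_mul, Real.rpow_zero, mul_one]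
        rw [show |Q₂ (a x)| * |G₁ (b x)| * |k x| * |u x| * |v x| =
          (|Q₂ (a x)| * |G₁ (b x)|) * (|k x| * |u x| * |v x|) by ring]
        gcongr
        exacts [bQ₂ _, bG₁ _])).1
  -- the first derivative in the first variable
  have d1 : ∀ a b, HasFDerivAt (fun a' => Dv a' b) (A₁ a b) a := by
    intro a b
    refine hasFDerivAt_of_norm_le_rpow (ε := 1) (K := C *
      (eLpNorm (fun x => 1 + |G (b x)|) (ENNReal.ofReal lam) μ).toReal) one_pos fun k => ?_
    have e : Dv (a + k) b - Dv a b - A₁ a b k =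
        ∫ x, ((P (a x + k x) + Q (a x + k x) * G (b x)) - (P (a x) + Q (a x) * G (b x)) -
          (P₁ (a x) + Q₁ (a x) * G (b x)) * k x) ∂μ := by
      rw [hDv, hDv, hA₁, integral_sub_sub (i0 _ _) (i0 _ _) (ilin (mF₁ a b) k)]
      refine integral_congr_ae ?_
      filter_upwards [Lp.coeFn_add a k] with x hx
      rw [hx, Pi.add_apply]; ring
    have := (integrable_and_abs_integral_le (μ := μ) (ε := 0) (C := C) le_rfl (by linarith)
      (mW b) (Lp.memLp k) (Lp.memLp k) m1
      (F := fun x => (P (a x + k x) + Q (a x + k x) * G (b x)) - (P (a x) + Q (a x) * G (b x)) -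
          (P₁ (a x) + Q₁ (a x) * G (b x)) * k x)
      ((((cP.comp_aestronglyMeasurable ((Lp.memLp a).1.add (Lp.memLp k).1)).add
        ((cQ.comp_aestronglyMeasurable ((Lp.memLp a).1.add (Lp.memLp k).1)).mul (mG b).1)).sub
        ((cP.comp_aestronglyMeasurable (Lp.memLp a).1).add
        ((cQ.comp_aestronglyMeasurable (Lp.memLp a).1).mul (mG b).1))).sub
        ((mF₁ a b).1.mul (Lp.memLp k).1)) hC
      (.of_forall fun x => by
        have := abs_sub_sub_le_of_holder (f := fun s => P s + Q s * G (b x))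
          (f' := fun s => P₁ s + Q₁ s * G (b x)) (K := C * (1 + |G (b x)|)) (ε := 1)
          (fun s => (hP s).add ((hQ s).mul_const _)) zero_le_one (by positivity)
          (fun s t => by
            rw [Real.rpow_one]
            exact abs_sub_le_of_hasDerivAt_bound
              (fun s => (hP₁ s).add ((hQ₁ s).mul_const (G (b x))))
              (fun s => abs_add_mul_le (bP₂ _) (bQ₂ _)) s t) (a x) (k x)
        rw [Real.rpow_one] at this
        refine this.trans (le_of_eq ?_)
        rw [Real.rpow_zero, abs_of_nonneg (show 0 ≤ 1 + |G (b x)| by positivity)]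
        ring)).2
    rw [e, Real.norm_eq_abs, Real.rpow_one]
    refine this.trans (le_of_eq ?_)
    rw [Lp.norm_def, Real.rpow_zero]
    ring
  -- Hölder bounds for the second derivative of the integrand
  have hold₂ : ∀ t s s' : ℝ, |(P₂ s + Q₂ s * G t) - (P₂ s' + Q₂ s' * G t)| ≤
      2 * (C * (1 + |G t|)) * |s - s'| ^ ε := fun t s s' =>
    abs_sub_le_rpow_of_bounds (f := fun s => P₂ s + Q₂ s * G t)
      (fun s => (hP₂ s).add ((hQ₂ s).mul_const (G t))) hε hε1
      (fun s => abs_add_mul_le (bP₂ _) (bQ₂ _)) (fun s => abs_add_mul_le (bP₃ _) (bQ₃ _)) s s'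
  -- the second derivative in the first variable
  have d2 : ∀ a b, HasFDerivAt (fun a' => A₁ a' b) (A₂ a b) a := by
    intro a b
    refine hasFDerivAt_of_norm_le_rpow (ε := ε) (K := 2 * C *
      (eLpNorm (fun x => 1 + |G (b x)|) (ENNReal.ofReal lam) μ).toReal) hε fun k => ?_
    refine ContinuousLinearMap.opNorm_le_bound _ (by positivity) fun u => ?_
    have e : (A₁ (a + k) b - A₁ a b - A₂ a b k) u =
        ∫ x, ((P₁ (a x + k x) + Q₁ (a x + k x) * G (b x)) - (P₁ (a x) + Q₁ (a x) * G (b x)) -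
          (P₂ (a x) + Q₂ (a x) * G (b x)) * k x) * u x ∂μ := by
      rw [sub_apply, sub_apply, hA₁, hA₁, hA₂,
        integral_sub_sub (ilin (mF₁ _ _) u) (ilin (mF₁ _ _) u) (ibil (mF₂ a b) k u)]
      refine integral_congr_ae ?_
      filter_upwards [Lp.coeFn_add a k] with x hx
      rw [hx, Pi.add_apply]; ring
    have := (integrable_and_abs_integral_le (μ := μ) (ε := ε) (C := 2 * C) hε.le hεl
      (mW b) (Lp.memLp k) (Lp.memLp u) (Lp.memLp k)
      (F := fun x => ((P₁ (a x + k x) + Q₁ (a x + k x) * G (b x)) -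
        (P₁ (a x) + Q₁ (a x) * G (b x)) - (P₂ (a x) + Q₂ (a x) * G (b x)) * k x) * u x)
      (((((cP₁.comp_aestronglyMeasurable ((Lp.memLp a).1.add (Lp.memLp k).1)).add
        ((cQ₁.comp_aestronglyMeasurable ((Lp.memLp a).1.add (Lp.memLp k).1)).mul (mG b).1)).sub
        (mF₁ a b).1).sub
        ((mF₂ a b).1.mul (Lp.memLp k).1)).mul (Lp.memLp u).1) (by positivity)
      (.of_forall fun x => by
        have := abs_sub_sub_le_of_holder (f := fun s => P₁ s + Q₁ s * G (b x))
          (f' := fun s => P₂ s + Q₂ s * G (b x))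
          (fun s => (hP₁ s).add ((hQ₁ s).mul_const _)) hε.le (by positivity)
          (hold₂ (b x)) (a x) (k x)
        rw [abs_mul]
        refine (mul_le_mul_of_nonneg_right this (abs_nonneg _)).trans (le_of_eq ?_)
        rw [abs_of_nonneg (show 0 ≤ 1 + |G (b x)| by positivity)]
        ring)).2
    rw [e, Real.norm_eq_abs]
    refine this.trans (le_of_eq ?_)
    simp only [Lp.norm_def]
    ring
  have c2 : ∀ b, Continuous fun a => A₂ a b := by
    intro b
    refine continuous_of_norm_sub_le_rpow (f := fun a => A₂ a b) (K := 2 * C *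
      (eLpNorm (fun x => 1 + |G (b x)|) (ENNReal.ofReal lam) μ).toReal) hε fun a a' => ?_
    refine ContinuousLinearMap.opNorm_le_bound₂ _ (by positivity) fun h u => ?_
    have e : (A₂ a b - A₂ a' b) h u =
        ∫ x, ((P₂ (a x) + Q₂ (a x) * G (b x)) - (P₂ (a' x) + Q₂ (a' x) * G (b x))) *
          h x * u x ∂μ := by
      rw [sub_apply, sub_apply, hA₂, hA₂, ← integral_sub (ibil (mF₂ _ _) h u) (ibil (mF₂ _ _) h u)]
      refine integral_congr_ae (.of_forall fun x => ?_)
      ring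
    have := (integrable_and_abs_integral_le (μ := μ) (ε := ε) (C := 2 * C) hε.le hεl
      (mW b) (Lp.memLp h) (Lp.memLp u) (Lp.memLp (a - a'))
      (F := fun x => ((P₂ (a x) + Q₂ (a x) * G (b x)) - (P₂ (a' x) + Q₂ (a' x) * G (b x))) *
          h x * u x)
      ((((mF₂ a b).1.sub (mF₂ a' b).1).mul (Lp.memLp h).1).mul (Lp.memLp u).1) (by positivity)
      (by
        filter_upwards [Lp.coeFn_sub a a'] with x hx
        rw [hx, Pi.sub_apply, abs_mul, abs_mul, mul_assoc]
        refine (mul_le_mul_of_nonneg_right (hold₂ (b x) (a x) (a' x)) (by positivity)).trans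
          (le_of_eq ?_)
        rw [abs_of_nonneg (show 0 ≤ 1 + |G (b x)| by positivity)]
        ring)).2
    rw [e, Real.norm_eq_abs]
    refine this.trans (le_of_eq ?_)
    simp only [Lp.norm_def]
    ring
  -- the derivative in the second variable
  have d3 : ∀ a b, HasFDerivAt (fun b' => A₂ a b') (A₃ a b) b := by
    intro a b
    refine hasFDerivAt_of_norm_le_rpow (f := fun b' => A₂ a b') (f' := A₃ a b) (ε := ε)
      (K := 2 * C * C) hε fun k => ?_
    refine ContinuousLinearMap.opNorm_le_bound₂ _ (by positivity) fun h u => ?_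
    have e : (A₂ a (b + k) - A₂ a b - A₃ a b k) h u =
        ∫ x, Q₂ (a x) * (G (b x + k x) - G (b x) - G₁ (b x) * k x) * h x * u x ∂μ := by
      rw [sub_apply, sub_apply, sub_apply, sub_apply, hA₂, hA₂, hA₃,
        integral_sub_sub (ibil (mF₂ _ _) h u) (ibil (mF₂ _ _) h u) (itri a b k h u)]
      refine integral_congr_ae ?_
      filter_upwards [Lp.coeFn_add b k] with x hx
      rw [hx, Pi.add_apply]; ring
    have := (integrable_and_abs_integral_le (μ := μ) (ε := ε) (C := 2 * C * C) hε.le hεl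
      (Lp.memLp k) (Lp.memLp h) (Lp.memLp u) (Lp.memLp k)
      (F := fun x => Q₂ (a x) * (G (b x + k x) - G (b x) - G₁ (b x) * k x) * h x * u x)
      ((((cQ₂.comp_aestronglyMeasurable (Lp.memLp a).1).mul
        (((cG.comp_aestronglyMeasurable ((Lp.memLp b).1.add (Lp.memLp k).1)).sub (mG b).1).sub
        ((cG₁.comp_aestronglyMeasurable (Lp.memLp b).1).mul (Lp.memLp k).1))).mul
        (Lp.memLp h).1).mul (Lp.memLp u).1) (by positivity)
      (.of_forall fun x => by
        have := abs_sub_sub_le_of_holder hG hε.le (K := 2 * C) (by positivity)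
          (abs_sub_le_rpow_of_bounds hG₁ hε hε1 bG₁ bG₂) (b x) (k x)
        rw [abs_mul, abs_mul, abs_mul]
        calc _ ≤ C * (2 * C * |k x| * |k x| ^ ε) * |h x| * |u x| := by
              gcongr
              exact bQ₂ _
          _ = _ := by ring)).2
    rw [e, Real.norm_eq_abs]
    refine this.trans (le_of_eq ?_)
    simp only [Lp.norm_def]
    ring
  obtain ⟨r1, r2⟩ := contDiff_two_and_hasFDerivAt_iteratedFDeriv d1 d2 c2 d3
  refine ⟨r1, fun a b => (r2 a b).1, fun a b u v w => ?_⟩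
  rw [(r2 a b).2]
  exact hA₃ a b w u v

end Nemytskii

section InverseChart

variable {ψ : ℝ → ℝ}

lemma hasDerivAt_inverse_add_log (hψ : ∀ z : ℝ, 0 < ψ z ∧ ψ z + Real.log (ψ z) = z) (s : ℝ) :
    HasDerivAt ψ (ψ s / (1 + ψ s)) s := by
  have hmono : ∀ s t, ψ s ≤ ψ t → ψ t - ψ s ≤ t - s := by
    intro s t h
    have := Real.log_le_log (hψ s).1 h
    linarith [(hψ s).2, (hψ t).2]
  have hlip : LipschitzWith 1 ψ := by
    refine LipschitzWith.of_dist_le_mul fun s t => ?_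
    simp only [NNReal.coe_one, one_mul, Real.dist_eq]
    rcases le_total (ψ s) (ψ t) with h | h
    · rw [abs_sub_comm, abs_of_nonneg (sub_nonneg.2 h), abs_sub_comm]
      exact (hmono s t h).trans (le_abs_self _)
    · rw [abs_of_nonneg (sub_nonneg.2 h)]
      exact (hmono t s h).trans (le_abs_self _)
  have hpos := (hψ s).1
  have h1 : HasDerivAt (fun y => y + Real.log y) (1 + (ψ s)⁻¹) (ψ s) :=
    (hasDerivAt_id _).add (Real.hasDerivAt_log hpos.ne')
  have h2 := HasDerivAt.of_local_left_inverse hlip.continuous.continuousAt h1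
    (by positivity) (.of_forall fun z => (hψ z).2)
  convert! h2 using 1
  field_simp
  ring

lemma inverse_add_log_le (hψ : ∀ z : ℝ, 0 < ψ z ∧ ψ z + Real.log (ψ z) = z) (s : ℝ) :
    ψ s ≤ 1 + |s| := by
  rcases le_total (ψ s) 1 with h | h
  · linarith [abs_nonneg s]
  · linarith [Real.log_nonneg h, (hψ s).2, le_abs_self s]

lemma hasDerivAt_rpow_inverse (hψ : ∀ z : ℝ, 0 < ψ z ∧ ψ z + Real.log (ψ z) = z) (β s : ℝ) :
    HasDerivAt (fun s => ψ s ^ β) (β * ψ s ^ β / (1 + ψ s)) s := by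
  have hpos := (hψ s).1
  convert! (hasDerivAt_inverse_add_log hψ s).rpow_const (p := β) (.inl hpos.ne') using 1
  rw [Real.rpow_sub_one hpos.ne']
  field_simp

lemma hasDerivAt_rpow_inverse_deriv (hψ : ∀ z : ℝ, 0 < ψ z ∧ ψ z + Real.log (ψ z) = z)
    (β s : ℝ) : HasDerivAt (fun s => β * ψ s ^ β / (1 + ψ s))
      (β * ψ s ^ β * (β - (1 - β) * ψ s) / (1 + ψ s) ^ 3) s := by
  have hpos := (hψ s).1
  convert! ((hasDerivAt_rpow_inverse hψ β s).const_mul β).div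
    ((hasDerivAt_inverse_add_log hψ s).const_add 1) (by positivity) using 1
  field_simp
  ring

lemma hasDerivAt_rpow_inverse_deriv2 (hψ : ∀ z : ℝ, 0 < ψ z ∧ ψ z + Real.log (ψ z) = z)
    (β s : ℝ) : HasDerivAt (fun s => β * ψ s ^ β * (β - (1 - β) * ψ s) / (1 + ψ s) ^ 3)
      (β * ψ s ^ β * (β * (β - (1 - β) * ψ s) * (1 + ψ s) - (1 - β) * ψ s * (1 + ψ s) -
        3 * ψ s * (β - (1 - β) * ψ s)) / (1 + ψ s) ^ 5) s := by
  have hpos := (hψ s).1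
  have h := hasDerivAt_inverse_add_log hψ s
  convert! (((hasDerivAt_rpow_inverse hψ β s).const_mul β).mul
    ((h.const_mul (1 - β)).const_sub β)).div ((h.const_add 1).pow 3)
    (by simp only [Pi.pow_apply]; positivity) using 1
  simp only [Pi.mul_apply, Pi.pow_apply, Nat.cast_ofNat]
  field_simp
  ring

lemma rpow_le_one_add {y β : ℝ} (hy : 0 < y) (h0 : 0 ≤ β) (h1 : β ≤ 1) : y ^ β ≤ 1 + y := by
  calc y ^ β ≤ (1 + y) ^ β := by gcongr; linarith
    _ ≤ (1 + y) ^ (1 : ℝ) := Real.rpow_le_rpow_of_exponent_le (by linarith) h1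
    _ = 1 + y := Real.rpow_one _

lemma abs_rpow_inverse_deriv_le {y β : ℝ} (hy : 0 < y) (h0 : 0 ≤ β) (h1 : β ≤ 1) :
    |β * y ^ β / (1 + y)| ≤ 8 := by
  have hb := rpow_le_one_add hy h0 h1
  rw [abs_of_nonneg (by positivity), div_le_iff₀ (by positivity)]
  nlinarith [Real.rpow_pos_of_pos hy β]

lemma abs_rpow_inverse_deriv2_le {y β : ℝ} (hy : 0 < y) (h0 : 0 ≤ β) (h1 : β ≤ 1) :
    |β * y ^ β * (β - (1 - β) * y) / (1 + y) ^ 3| ≤ 8 := by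
  have hb := rpow_le_one_add hy h0 h1
  have hc : |β - (1 - β) * y| ≤ 1 + y := by
    rw [abs_le]; constructor <;> nlinarith
  rw [abs_div, abs_mul, abs_of_nonneg (show 0 ≤ β * y ^ β by positivity),
    abs_of_nonneg (show 0 ≤ (1 + y) ^ 3 by positivity), div_le_iff₀ (by positivity)]
  calc β * y ^ β * |β - (1 - β) * y| ≤ 1 * (1 + y) * (1 + y) := by gcongr
    _ ≤ 8 * (1 + y) ^ 3 := by nlinarith [pow_pos hy 3, pow_pos hy 2]

lemma abs_rpow_inverse_deriv3_le {y β : ℝ} (hy : 0 < y) (h0 : 0 ≤ β) (h1 : β ≤ 1) :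
    |β * y ^ β * (β * (β - (1 - β) * y) * (1 + y) - (1 - β) * y * (1 + y) -
        3 * y * (β - (1 - β) * y)) / (1 + y) ^ 5| ≤ 8 := by
  have hb := rpow_le_one_add hy h0 h1
  have hc : |β - (1 - β) * y| ≤ 1 + y := by
    rw [abs_le]; constructor <;> nlinarith
  have hd : |β * (β - (1 - β) * y) * (1 + y) - (1 - β) * y * (1 + y) -
        3 * y * (β - (1 - β) * y)| ≤ 5 * (1 + y) ^ 2 := by
    have e1 : |β * (β - (1 - β) * y) * (1 + y)| ≤ 1 * (1 + y) * (1 + y) := by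
      rw [abs_mul, abs_mul, abs_of_nonneg h0, abs_of_nonneg (show 0 ≤ 1 + y by positivity)]
      gcongr
    have e2 : |(1 - β) * y * (1 + y)| ≤ 1 * (1 + y) * (1 + y) := by
      rw [abs_of_nonneg (by have := sub_nonneg.2 h1; positivity)]
      gcongr <;> linarith
    have e3 : |3 * y * (β - (1 - β) * y)| ≤ 3 * (1 + y) * (1 + y) := by
      rw [abs_mul, abs_of_nonneg (show 0 ≤ 3 * y by positivity)]
      gcongr; linarith
    refine ((abs_sub _ _).trans (add_le_add ((abs_sub _ _).trans (add_le_add e1 e2)) e3)).trans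
      (le_of_eq ?_)
    ring
  rw [abs_div, abs_mul, abs_of_nonneg (show 0 ≤ β * y ^ β by positivity),
    abs_of_nonneg (show 0 ≤ (1 + y) ^ 5 by positivity), div_le_iff₀ (by positivity)]
  calc _ ≤ 1 * (1 + y) * (5 * (1 + y) ^ 2) := by gcongr
    _ = 5 * (1 + y) ^ 3 := by ring
    _ ≤ 8 * (1 + y) ^ 5 := by
      gcongr
      · norm_num
      · linarith
      · norm_num

lemma hasDerivAt_log_inverse (hψ : ∀ z : ℝ, 0 < ψ z ∧ ψ z + Real.log (ψ z) = z) (s : ℝ) :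
    HasDerivAt (fun s => Real.log (ψ s)) (1 / (1 + ψ s)) s := by
  have hpos := (hψ s).1
  convert! (hasDerivAt_inverse_add_log hψ s).log hpos.ne' using 1
  field_simp

lemma hasDerivAt_log_inverse_deriv (hψ : ∀ z : ℝ, 0 < ψ z ∧ ψ z + Real.log (ψ z) = z) (s : ℝ) :
    HasDerivAt (fun s => 1 / (1 + ψ s)) (-ψ s / (1 + ψ s) ^ 3) s := by
  have hpos := (hψ s).1
  convert! (hasDerivAt_const s (1 : ℝ)).div
    ((hasDerivAt_inverse_add_log hψ s).const_add 1) (by positivity) using 1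
  field_simp
  ring

lemma hasDerivAt_log_inverse_deriv2 (hψ : ∀ z : ℝ, 0 < ψ z ∧ ψ z + Real.log (ψ z) = z) (s : ℝ) :
    HasDerivAt (fun s => -ψ s / (1 + ψ s) ^ 3) (-ψ s * (1 - 2 * ψ s) / (1 + ψ s) ^ 5) s := by
  have hpos := (hψ s).1
  have h := hasDerivAt_inverse_add_log hψ s
  convert! h.neg.div ((h.const_add 1).pow 3)
    (by simp only [Pi.pow_apply]; positivity) using 1
  simp only [Pi.neg_apply, Pi.pow_apply, Nat.cast_ofNat]
  field_simp
  ring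

lemma abs_log_inverse_deriv_le {y : ℝ} (hy : 0 < y) : |1 / (1 + y)| ≤ 8 := by
  rw [abs_of_nonneg (by positivity), div_le_iff₀ (by positivity)]
  linarith

lemma abs_log_inverse_deriv2_le {y : ℝ} (hy : 0 < y) : |-y / (1 + y) ^ 3| ≤ 8 := by
  rw [neg_div, abs_neg, abs_of_nonneg (by positivity), div_le_iff₀ (by positivity)]
  nlinarith [pow_pos hy 3, pow_pos hy 2]

lemma abs_log_inverse_deriv3_le {y : ℝ} (hy : 0 < y) :
    |-y * (1 - 2 * y) / (1 + y) ^ 5| ≤ 8 := by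
  rw [abs_div, abs_of_nonneg (show 0 ≤ (1 + y) ^ 5 by positivity), div_le_iff₀ (by positivity),
    abs_le]
  constructor <;> nlinarith [pow_pos hy 5, pow_pos hy 4, pow_pos hy 3, pow_pos hy 2]

lemma hasDerivAt_entropy_inverse (hψ : ∀ z : ℝ, 0 < ψ z ∧ ψ z + Real.log (ψ z) = z) (s : ℝ) :
    HasDerivAt (fun s => ψ s * Real.log (ψ s) - ψ s) (ψ s * Real.log (ψ s) / (1 + ψ s)) s := by
  have hpos := (hψ s).1
  have h := hasDerivAt_inverse_add_log hψ s
  convert! (h.mul (hasDerivAt_log_inverse hψ s)).sub h using 1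
  field_simp
  ring

lemma hasDerivAt_entropy_inverse_deriv (hψ : ∀ z : ℝ, 0 < ψ z ∧ ψ z + Real.log (ψ z) = z)
    (s : ℝ) : HasDerivAt (fun s => ψ s * Real.log (ψ s) / (1 + ψ s))
      (ψ s * Real.log (ψ s) / (1 + ψ s) ^ 3 + ψ s / (1 + ψ s) ^ 2) s := by
  have hpos := (hψ s).1
  have h := hasDerivAt_inverse_add_log hψ s
  convert! (h.mul (hasDerivAt_log_inverse hψ s)).div (h.const_add 1) (by positivity) using 1
  simp only [Pi.mul_apply]
  field_simp
  ring

lemma hasDerivAt_entropy_inverse_deriv2 (hψ : ∀ z : ℝ, 0 < ψ z ∧ ψ z + Real.log (ψ z) = z)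
    (s : ℝ) :
    HasDerivAt (fun s => ψ s * Real.log (ψ s) / (1 + ψ s) ^ 3 + ψ s / (1 + ψ s) ^ 2)
      ((ψ s * Real.log (ψ s) * (1 - 2 * ψ s) + ψ s * (2 + ψ s - ψ s ^ 2)) /
        (1 + ψ s) ^ 5) s := by
  have hpos := (hψ s).1
  have h := hasDerivAt_inverse_add_log hψ s
  convert! ((h.mul (hasDerivAt_log_inverse hψ s)).div ((h.const_add 1).pow 3)
    (by simp only [Pi.pow_apply]; positivity)).add
    (h.div ((h.const_add 1).pow 2) (by simp only [Pi.pow_apply]; positivity)) using 1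
  simp only [Pi.mul_apply, Pi.pow_apply, Nat.cast_ofNat]
  field_simp
  ring

lemma abs_mul_log_le {y : ℝ} (hy : 0 < y) : |y * Real.log y| ≤ (1 + y) ^ 2 := by
  have h1 := Real.log_le_sub_one_of_pos hy
  have h2 := Real.one_sub_inv_le_log_of_pos hy
  have h3 : y - 1 ≤ y * Real.log y := by
    have := mul_le_mul_of_nonneg_left h2 hy.le
    rwa [mul_sub, mul_one, mul_inv_cancel₀ hy.ne'] at this
  rw [abs_le]
  constructor <;> nlinarith

lemma abs_entropy_inverse_deriv_le (hψ : ∀ z : ℝ, 0 < ψ z ∧ ψ z + Real.log (ψ z) = z) (s : ℝ) :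
    |ψ s * Real.log (ψ s) / (1 + ψ s)| ≤ 8 * (1 + |s|) := by
  have hy := (hψ s).1
  have h1 := inverse_add_log_le hψ s
  rw [abs_div, abs_of_nonneg (show 0 ≤ 1 + ψ s by positivity), div_le_iff₀ (by positivity)]
  calc |ψ s * Real.log (ψ s)| ≤ (1 + ψ s) ^ 2 := abs_mul_log_le hy
    _ = (1 + ψ s) * (1 + ψ s) := sq _
    _ ≤ 8 * (1 + |s|) * (1 + ψ s) := by
      gcongr
      linarith [abs_nonneg s]

lemma abs_entropy_inverse_deriv2_le {y : ℝ} (hy : 0 < y) :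
    |y * Real.log y / (1 + y) ^ 3 + y / (1 + y) ^ 2| ≤ 8 := by
  have h := abs_le.1 (abs_mul_log_le hy)
  rw [show y * Real.log y / (1 + y) ^ 3 + y / (1 + y) ^ 2 =
    (y * Real.log y + y * (1 + y)) / (1 + y) ^ 3 by field_simp,
    abs_div, abs_of_nonneg (show 0 ≤ (1 + y) ^ 3 by positivity), div_le_iff₀ (by positivity),
    abs_le]
  constructor <;> nlinarith [pow_pos hy 3, pow_pos hy 2]

lemma abs_entropy_inverse_deriv3_le {y : ℝ} (hy : 0 < y) :
    |(y * Real.log y * (1 - 2 * y) + y * (2 + y - y ^ 2)) / (1 + y) ^ 5| ≤ 8 := by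
  have h1 : |y * Real.log y * (1 - 2 * y)| ≤ (1 + y) ^ 2 * (2 * (1 + y)) := by
    rw [abs_mul]
    gcongr
    · exact abs_mul_log_le hy
    · rw [abs_le]; constructor <;> linarith
  have h2 : |y * (2 + y - y ^ 2)| ≤ 2 * (1 + y) ^ 3 := by
    rw [abs_le]; constructor <;> nlinarith [pow_pos hy 3, pow_pos hy 2]
  rw [abs_div, abs_of_nonneg (show 0 ≤ (1 + y) ^ 5 by positivity), div_le_iff₀ (by positivity)]
  calc _ ≤ (1 + y) ^ 2 * (2 * (1 + y)) + 2 * (1 + y) ^ 3 := (abs_add_le _ _).trans (add_le_add h1 h2)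
    _ = 4 * (1 + y) ^ 3 := by ring
    _ ≤ 8 * (1 + y) ^ 5 := by
      gcongr
      · norm_num
      · linarith
      · norm_num

end InverseChart

/-- mixed third derivative of the `α`-divergence on the diagonal: for
`λ > 3` and `α ∈ [−1,1]`, the chart expression of the `α`-divergence admits the mixed
third partial Fréchet derivative `D₁²D₂`, and on the diagonal `b̃ = ã`, with `p = ψ∘ã`,
`D₁²D₂D_α(φ̃^{-1}|φ̃^{-1})_{ã,ã}(ũ,ṽ;w̃) = −E_μ[(p/(1+p)²) Γ̃_α(ã,ũ,ṽ) w̃]`, where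
`Γ̃_α(ã,ũ,ṽ) = ((1−α)/2)·ũṽ/(1+p)² − ((1+α)/2)·p·ũṽ/(1+p)²`. -/
theorem stmt_19 {X : Type*} [MeasurableSpace X] (μ : Measure X) [IsProbabilityMeasure μ]
    (lam : ℝ) (hlam : 3 < lam) [Fact (1 ≤ ENNReal.ofReal lam)]
    (ψ : ℝ → ℝ) (hψ : ∀ z : ℝ, 0 < ψ z ∧ ψ z + Real.log (ψ z) = z)
    (α : ℝ) (hα : α ∈ Icc (-1 : ℝ) 1)
    (Dv : Lp ℝ (ENNReal.ofReal lam) μ → Lp ℝ (ENNReal.ofReal lam) μ → ℝ)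
    (hDv : ∀ a b : Lp ℝ (ENNReal.ofReal lam) μ, Dv a b =
      if α = -1 then
        ∫ x, (ψ (b x) - ψ (a x) + ψ (a x) * Real.log (ψ (a x) / ψ (b x))) ∂μ
      else if α = 1 then
        ∫ x, (ψ (a x) - ψ (b x) + ψ (b x) * Real.log (ψ (b x) / ψ (a x))) ∂μ
      else
        ∫ x, ((2 / (1 + α)) * ψ (a x) + (2 / (1 - α)) * ψ (b x) -
          (4 / (1 - α ^ 2)) * ψ (a x) ^ ((1 - α) / 2) * ψ (b x) ^ ((1 + α) / 2)) ∂μ) :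
    -- D₁² exists
    (∀ b : Lp ℝ (ENNReal.ofReal lam) μ, ContDiff ℝ 2 (fun a => Dv a b)) ∧
    -- D₁²D₂ exists
    (∀ a b : Lp ℝ (ENNReal.ofReal lam) μ,
      DifferentiableAt ℝ (fun b' => iteratedFDeriv ℝ 2 (fun a' => Dv a' b') a) b) ∧
    -- the formula on the diagonal b̃ = ã
    (∀ a : Lp ℝ (ENNReal.ofReal lam) μ, ∀ u v w : Lp ℝ (ENNReal.ofReal lam) μ,
      fderiv ℝ (fun b' => iteratedFDeriv ℝ 2 (fun a' => Dv a' b') a) a w ![u, v] =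
        -∫ x, (ψ (a x) / (1 + ψ (a x)) ^ 2) *
          (((1 - α) / 2) * (u x * v x) / (1 + ψ (a x)) ^ 2 -
            ((1 + α) / 2) * ψ (a x) * (u x * v x) / (1 + ψ (a x)) ^ 2) * w x ∂μ) := by
  have hpos : ∀ s, 0 < ψ s := fun s => (hψ s).1
  have hR0 : ∀ s : ℝ, (8 : ℝ) ≤ 8 * (1 + |s|) := fun s => by linarith [abs_nonneg s]
  rcases eq_or_ne α (-1) with h1 | h1
  · subst h1
    obtain ⟨r1, r2, r3⟩ := mixed_third_deriv_integral (μ := μ) hlam (C := 8) (Dv := Dv)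
      (hasDerivAt_entropy_inverse hψ) (hasDerivAt_entropy_inverse_deriv hψ)
      (hasDerivAt_entropy_inverse_deriv2 hψ)
      (fun s => abs_entropy_inverse_deriv2_le (hpos s))
      (fun s => abs_entropy_inverse_deriv3_le (hpos s))
      (fun s => (hasDerivAt_rpow_inverse hψ 1 s).neg)
      (fun s => (hasDerivAt_rpow_inverse_deriv hψ 1 s).neg)
      (fun s => (hasDerivAt_rpow_inverse_deriv2 hψ 1 s).neg)
      (fun s => by
        rw [abs_neg]; exact abs_rpow_inverse_deriv_le (hpos s) zero_le_one le_rfl)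
      (fun s => by
        rw [abs_neg]; exact abs_rpow_inverse_deriv2_le (hpos s) zero_le_one le_rfl)
      (fun s => by
        rw [abs_neg]; exact abs_rpow_inverse_deriv3_le (hpos s) zero_le_one le_rfl)
      (hasDerivAt_log_inverse hψ) (hasDerivAt_log_inverse_deriv hψ)
      (fun s => abs_log_inverse_deriv_le (hpos s))
      (fun s => abs_log_inverse_deriv2_le (hpos s))
      (hasDerivAt_rpow_inverse hψ 1)
      (fun s => (abs_rpow_inverse_deriv_le (hpos s) zero_le_one le_rfl).trans (hR0 s))
      (fun a b => by
        rw [hDv, if_pos rfl]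
        congr 1 with x
        rw [Real.log_div (hpos _).ne' (hpos _).ne']
        simp only [Pi.neg_apply, Real.rpow_one]
        ring)
    refine ⟨r1, r2, fun a u v w => ?_⟩
    rw [r3, ← integral_neg]
    congr 1 with x
    have := hpos (a x)
    simp only [Real.rpow_one]
    field_simp
    ring
  rcases eq_or_ne α 1 with h2 | h2
  · subst h2
    obtain ⟨r1, r2, r3⟩ := mixed_third_deriv_integral (μ := μ) hlam (C := 8) (Dv := Dv)
      (hasDerivAt_rpow_inverse hψ 1) (hasDerivAt_rpow_inverse_deriv hψ 1)
      (hasDerivAt_rpow_inverse_deriv2 hψ 1)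
      (fun s => abs_rpow_inverse_deriv2_le (hpos s) zero_le_one le_rfl)
      (fun s => abs_rpow_inverse_deriv3_le (hpos s) zero_le_one le_rfl)
      (fun s => (hasDerivAt_log_inverse hψ s).neg)
      (fun s => (hasDerivAt_log_inverse_deriv hψ s).neg)
      (fun s => (hasDerivAt_log_inverse_deriv2 hψ s).neg)
      (fun s => by rw [abs_neg]; exact abs_log_inverse_deriv_le (hpos s))
      (fun s => by rw [abs_neg]; exact abs_log_inverse_deriv2_le (hpos s))
      (fun s => by rw [abs_neg]; exact abs_log_inverse_deriv3_le (hpos s))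
      (hasDerivAt_rpow_inverse hψ 1) (hasDerivAt_rpow_inverse_deriv hψ 1)
      (fun s => abs_rpow_inverse_deriv_le (hpos s) zero_le_one le_rfl)
      (fun s => abs_rpow_inverse_deriv2_le (hpos s) zero_le_one le_rfl)
      (hasDerivAt_entropy_inverse hψ) (abs_entropy_inverse_deriv_le hψ)
      (fun a b => by
        rw [hDv, if_neg h1, if_pos rfl]
        congr 1 with x
        rw [Real.log_div (hpos _).ne' (hpos _).ne']
        simp only [Pi.neg_apply, Real.rpow_one]
        ring)
    refine ⟨r1, r2, fun a u v w => ?_⟩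
    rw [r3, ← integral_neg]
    congr 1 with x
    have := hpos (a x)
    simp only [Real.rpow_one]
    field_simp
    ring
  have hα1 : 0 < 1 + α := by
    have := lt_of_le_of_ne hα.1 h1.symm
    linarith
  have hα2 : 0 < 1 - α := by
    have := lt_of_le_of_ne hα.2 h2
    linarith
  have hα3 : 0 < 1 - α ^ 2 := by
    rw [show 1 - α ^ 2 = (1 + α) * (1 - α) by ring]; positivity
  have hβ0 : 0 ≤ (1 - α) / 2 := by linarith
  have hβ1 : (1 - α) / 2 ≤ 1 := by linarith
  have hγ0 : 0 ≤ (1 + α) / 2 := by linarith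
  have hγ1 : (1 + α) / 2 ≤ 1 := by linarith
  set C : ℝ := 8 * (1 + 2 / (1 + α) + 2 / (1 - α) + 4 / (1 - α ^ 2)) with hC
  have k1 : 0 < 2 / (1 + α) := by positivity
  have k2 : 0 < 2 / (1 - α) := by positivity
  have k3 : 0 < 4 / (1 - α ^ 2) := by positivity
  have hC8 : 8 ≤ C := by rw [hC]; linarith
  have scale : ∀ {c y : ℝ}, 0 < c → 8 * c ≤ C → |y| ≤ 8 → |c * y| ≤ C := by
    intro c y hc hcC hy
    rw [abs_mul, abs_of_pos hc]
    nlinarith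
  have s1 : 8 * (2 / (1 + α)) ≤ C := by rw [hC]; linarith
  have s2 : 8 * (2 / (1 - α)) ≤ C := by rw [hC]; linarith
  have s3 : 8 * (4 / (1 - α ^ 2)) ≤ C := by rw [hC]; linarith
  obtain ⟨r1, r2, r3⟩ := mixed_third_deriv_integral (μ := μ) hlam (C := C) (Dv := Dv)
      (fun s => (hasDerivAt_rpow_inverse hψ 1 s).const_mul (2 / (1 + α)))
      (fun s => (hasDerivAt_rpow_inverse_deriv hψ 1 s).const_mul (2 / (1 + α)))
      (fun s => (hasDerivAt_rpow_inverse_deriv2 hψ 1 s).const_mul (2 / (1 + α)))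
      (fun s => scale k1 s1 (abs_rpow_inverse_deriv2_le (hpos s) zero_le_one le_rfl))
      (fun s => scale k1 s1 (abs_rpow_inverse_deriv3_le (hpos s) zero_le_one le_rfl))
      (fun s => ((hasDerivAt_rpow_inverse hψ ((1 - α) / 2) s).const_mul (4 / (1 - α ^ 2))).neg)
      (fun s =>
        ((hasDerivAt_rpow_inverse_deriv hψ ((1 - α) / 2) s).const_mul (4 / (1 - α ^ 2))).neg)
      (fun s =>
        ((hasDerivAt_rpow_inverse_deriv2 hψ ((1 - α) / 2) s).const_mul (4 / (1 - α ^ 2))).neg)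
      (fun s => by
        rw [abs_neg]; exact scale k3 s3 (abs_rpow_inverse_deriv_le (hpos s) hβ0 hβ1))
      (fun s => by
        rw [abs_neg]; exact scale k3 s3 (abs_rpow_inverse_deriv2_le (hpos s) hβ0 hβ1))
      (fun s => by
        rw [abs_neg]; exact scale k3 s3 (abs_rpow_inverse_deriv3_le (hpos s) hβ0 hβ1))
      (hasDerivAt_rpow_inverse hψ ((1 + α) / 2))
      (hasDerivAt_rpow_inverse_deriv hψ ((1 + α) / 2))
      (fun s => (abs_rpow_inverse_deriv_le (hpos s) hγ0 hγ1).trans hC8)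
      (fun s => (abs_rpow_inverse_deriv2_le (hpos s) hγ0 hγ1).trans hC8)
      (fun s => (hasDerivAt_rpow_inverse hψ 1 s).const_mul (2 / (1 - α)))
      (fun s => (scale k2 s2 (abs_rpow_inverse_deriv_le (hpos s) zero_le_one le_rfl)).trans
        (by nlinarith [abs_nonneg s]))
      (fun a b => by
        rw [hDv, if_neg h1, if_neg h2]
        congr 1 with x
        simp only [Pi.neg_apply, Real.rpow_one]
        ring)
  refine ⟨r1, r2, fun a u v w => ?_⟩
  rw [r3, ← integral_neg]
  congr 1 with x
  have hp := hpos (a x)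
  have hmul : ψ (a x) ^ ((1 - α) / 2) * ψ (a x) ^ ((1 + α) / 2) = ψ (a x) := by
    rw [← Real.rpow_add hp, show (1 - α) / 2 + (1 + α) / 2 = 1 by ring, Real.rpow_one]
  calc _ = -(4 / (1 - α ^ 2) * ((1 - α) / 2) * ((1 + α) / 2)) *
        (ψ (a x) ^ ((1 - α) / 2) * ψ (a x) ^ ((1 + α) / 2)) *
        ((1 - α) / 2 - (1 - (1 - α) / 2) * ψ (a x)) / (1 + ψ (a x)) ^ 4 * w x * u x * v x := by
        field_simp
    _ = _ := by
        rw [hmul, show 4 / (1 - α ^ 2) * ((1 - α) / 2) * ((1 + α) / 2) = 1 by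
          field_simp; ring]
        field_simp
        ring
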